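/- Let n ≥ 3 and let nK be the inverse limit continuum determined by the bonding map φ = nφ described in the context. Then every proper nondegenerate subcontinuum of nK is an arc. -/

import Mathlib

/-! ## Simple-n-ods in the plane, likeness, arcs, triods, indecomposability -/

/-- The simple-`n`-od `T_n ⊆ ℂ`: the union of `n` unit segments emanating from `0`. -/
def simpleOdSet (n : ℕ) : Set ℂ :=
  {z | ∃ t : ℝ, ∃ k : ℕ, t ∈ Set.Icc (0:ℝ) 1 ∧ k < n ∧
    z = (t : ℂ) * Complex.exp (2 * Real.pi * Complex.I * (k : ℂ) / (n : ℂ))}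

/-- `X` is `Y`-like: for every `ε > 0` there is a continuous surjection `X → Y`
all of whose point-inverses have diameter `< ε`. -/
def IsLike (X Y : Type*) [MetricSpace X] [MetricSpace Y] : Prop :=
  ∀ ε : ℝ, 0 < ε → ∃ g : X → Y, Continuous g ∧ Function.Surjective g ∧
    ∀ y : Y, Metric.diam (g ⁻¹' {y}) < ε

/-- `A` is an arc: it is homeomorphic to `[0,1]`. -/
def IsArcSet {K : Type*} [TopologicalSpace K] (A : Set K) : Prop :=
  Nonempty (↥A ≃ₜ ↥(Set.Icc (0:ℝ) 1))

/-- Two sets are mutually separated: neither meets the closure of the other. -/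
def MutuallySeparated {K : Type*} [TopologicalSpace K] (A B : Set K) : Prop :=
  A ∩ closure B = ∅ ∧ closure A ∩ B = ∅

/-- The (sub)continuum `C` is a triod: it contains a subcontinuum `M` such that
`C \ M` is the union of three nonempty pairwise mutually separated sets. -/
def IsTriodSet {K : Type*} [TopologicalSpace K] (C : Set K) : Prop :=
  ∃ M A B D : Set K, IsCompact M ∧ IsConnected M ∧ M ⊆ C ∧
    A.Nonempty ∧ B.Nonempty ∧ D.Nonempty ∧ C \ M = A ∪ B ∪ D ∧
    MutuallySeparated A B ∧ MutuallySeparated A D ∧ MutuallySeparated B D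

/-- A space is atriodic if it contains no subcontinuum which is a triod. -/
def AtriodicSpace (K : Type*) [TopologicalSpace K] : Prop :=
  ∀ C : Set K, IsCompact C → IsConnected C → ¬ IsTriodSet C

/-- A space is indecomposable if it is not the union of two proper subcontinua. -/
def IndecomposableSpace (K : Type*) [TopologicalSpace K] : Prop :=
  ¬ ∃ A B : Set K, IsCompact A ∧ IsConnected A ∧ IsCompact B ∧ IsConnected B ∧
    A ≠ Set.univ ∧ B ≠ Set.univ ∧ A ∪ B = Set.univ
/-! ## The simple-`n`-od `S`, the bonding map `φ = nφ`, and the continuum `nK` -/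

noncomputable section

/-- Arm-coordinate parametrization of the simple-`n`-od in `ℂ`: the pair `(k, t)`
is sent to the point at (clamped) parameter `t ∈ [0,1]` on the ray in the
direction `e^{2πik/n}`. -/
def embC (n : ℕ) (p : ℕ × ℝ) : ℂ :=
  ((min 1 (max 0 p.2) : ℝ) : ℂ) * Complex.exp (2 * Real.pi * Complex.I * (p.1 : ℂ) / (n : ℂ))

/-- The underlying simple-`n`-od `S ⊆ ℂ`. -/
def Sset (n : ℕ) : Set ℂ := Set.range (embC n)

/-- The simple-`n`-od `S` as a (compact metric) space. -/
abbrev Sspace (n : ℕ) := ↥(Sset n)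

/-- Arm coordinates `(ray index, parameter)` of the vertices `v_0, …, v_{n+2}`
of the graph `X_0`:  `v_0` is the branch point; for `1 ≤ i ≤ n-2`, `v_i` is the tip
of ray `i - 1`; `v_{n-1}` and `v_{n+1}` are the midpoint and tip of ray `n - 2`;
`v_n` and `v_{n+2}` are the midpoint and tip of ray `n - 1`. -/
def vcoord (n i : ℕ) : ℕ × ℝ :=
  if i = 0 then (0, 0)
  else if i ≤ n - 2 then (i - 1, 1)
  else if i = n - 1 then (n - 2, 1 / 2)
  else if i = n then (n - 1, 1 / 2)
  else if i = n + 1 then (n - 2, 1)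
  else (n - 1, 1)

/-- The vertex `v_i` of `X_0` as a point of `S`. -/
def vpt (n i : ℕ) : Sspace n := ⟨embC n (vcoord n i), Set.mem_range_self _⟩

/-- The branch point `v_0` of `S`. -/
def centerPt (n : ℕ) : Sspace n := vpt n 0

/-- Affine interpolation, in arm coordinates, between two adjacent vertices of
`X_0` (they lie on a common ray; if one of them is the branch point, the ray of
the other one is used). -/
def interpC (w w' : ℕ × ℝ) (s : ℝ) : ℕ × ℝ :=
  (if w.2 = 0 then w'.1 else w.1, (1 - s) * w.2 + s * w'.2)

/-- Arm coordinates of the `φ`-image of the `j`-th vertex of `X_1` (counted from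
`v_0` outwards) on the `a`-th arm of `X_1` (`1 ≤ a ≤ n`), following the defining
table of `φ = nφ`:

* arm `a ≤ n - 3` has vertices `v_0, u_a, u_{(n-3)+a}, …, u_{2(n-1)(n-3)+a}, v_a`;
* arm `n - 2` has vertices `v_0, u_{(2n-1)(n-3)+2(n-1)+1}, v_{n-2}`;
* arm `n - 1` has vertices `v_0, u_{(2n-1)(n-3)+2(n-1)+2}, u_{(2n-1)(n-3)+2(n-1)+3},
  v_{n-1}, v_{n+1}`;
* arm `n` has vertices `v_0, u_{(2n-1)(n-3)+1}, …, u_{(2n-1)(n-3)+2(n-1)}, v_n, v_{n+2}`. -/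
def imgCoord (n a j : ℕ) : ℕ × ℝ :=
  if a = n then
    (if j = 0 then vcoord n 0
     else if j ≤ 2 * n - 2 then
       (if j = 1 then vcoord n (n - 1)
        else if j % 2 = 0 then vcoord n 0
        else if j = 3 then vcoord n (n - 2)
        else vcoord n ((j - 3) / 2))
     else if j = 2 * n - 1 then vcoord n n
     else vcoord n (n + 2))
  else if a = n - 1 then
    (if j = 0 then vcoord n 0
     else if j = 1 then vcoord n (n - 1)
     else if j = 2 then vcoord n 0
     else if j = 3 then vcoord n n
     else vcoord n (n + 2))
  else if a = n - 2 then
    (if j = 0 then vcoord n 0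
     else if j = 1 then vcoord n (n - 1)
     else vcoord n (n + 1))
  else
    (if j = 0 then vcoord n 0
     else if j ≤ 2 * n - 1 then
       (if j = 1 then vcoord n (n - 1)
        else if j = 2 * n - 1 then vcoord n n
        else if (j - 1) % 2 = 1 then vcoord n 0
        else vcoord n ((a + (j - 1) / 2 - 2) % (n - 2) + 1))
     else vcoord n (n + 2))

/-- Locating a parameter `t ∈ [0,1]` on arm `a` of the subdivision `X_1`:
returns the index `j` of the edge of `X_1` containing the point together with the
affine coordinate `s ∈ [0,1]` inside this edge.  The vertices of `X_1` are placed
at: `j/(2n)` (`0 ≤ j ≤ 2n`) on arms `a ≤ n-3`; at `0, 1/2, 1` on arm `n-2`;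
at `0, 1/6, 2/6, 3/6, 1` on arm `n-1` (the vertices `v_{n-1}`, `v_{n+1}` sit at
`1/2` and `1`); and at `j/(4n-2)` (`0 ≤ j ≤ 2n-1`) followed by `1` on arm `n`
(the vertices `v_n`, `v_{n+2}` sit at `1/2` and `1`). -/
def segOf (n a : ℕ) (t : ℝ) : ℕ × ℝ :=
  if a = n then
    (if t ≤ 1 / 2 then
      (min (2 * n - 2) ⌊(4 * (n : ℝ) - 2) * t⌋₊,
        (4 * (n : ℝ) - 2) * t - (min (2 * n - 2) ⌊(4 * (n : ℝ) - 2) * t⌋₊ : ℕ))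
     else (2 * n - 1, 2 * t - 1))
  else if a = n - 1 then
    (if t ≤ 1 / 2 then
      (min 2 ⌊6 * t⌋₊, 6 * t - (min 2 ⌊6 * t⌋₊ : ℕ))
     else (3, 2 * t - 1))
  else if a = n - 2 then
    (min 1 ⌊2 * t⌋₊, 2 * t - (min 1 ⌊2 * t⌋₊ : ℕ))
  else
    (min (2 * n - 1) ⌊2 * (n : ℝ) * t⌋₊,
      2 * (n : ℝ) * t - (min (2 * n - 1) ⌊2 * (n : ℝ) * t⌋₊ : ℕ))

/-- The bonding map `φ` in arm coordinates: a point with arm coordinates `p` lies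
on arm `a = p.1 % n + 1` at parameter `t`; it lies in the `j`-th edge of `X_1`
on this arm with affine coordinate `s`, and is mapped to the corresponding affine
combination of the `φ`-images of the endpoints of this edge. -/
def Gmap (n : ℕ) (p : ℕ × ℝ) : ℕ × ℝ :=
  interpC (imgCoord n (p.1 % n + 1) (segOf n (p.1 % n + 1) (min 1 (max 0 p.2))).1)
    (imgCoord n (p.1 % n + 1) ((segOf n (p.1 % n + 1) (min 1 (max 0 p.2))).1 + 1))
    (segOf n (p.1 % n + 1) (min 1 (max 0 p.2))).2

/-- The piecewise-linear bonding map `f : S → S` induced by `φ`. -/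
def fS (n : ℕ) : Sspace n → Sspace n := fun z =>
  ⟨embC n (Gmap n (Function.invFun (embC n) (z : ℂ))), Set.mem_range_self _⟩

/-- The continuum `nK`: the inverse limit of the sequence `S ←f S ←f S ⋯`,
realized inside the countable product `S^ℕ`. -/
abbrev nK (n : ℕ) := {x : ℕ → Sspace n // ∀ k, fS n (x (k + 1)) = x k}

end

namespace OdInverseLimit

/-- The point of `S` with given arm coordinates. -/
noncomputable def pt (n : ℕ) (p : ℕ × ℝ) : Sspace n := ⟨embC n p, Set.mem_range_self _⟩

lemma norm_embC (n : ℕ) (p : ℕ × ℝ) : ‖embC n p‖ = min 1 (max 0 p.2) := by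
  have h : (2 * Real.pi * Complex.I * (p.1 : ℂ) / (n : ℂ))
      = ((2 * Real.pi * p.1 / n : ℝ) : ℂ) * Complex.I := by
    push_cast; ring
  rw [embC, h, norm_mul, Complex.norm_exp_ofReal_mul_I, mul_one, Complex.norm_real,
    Real.norm_of_nonneg]
  exact le_min zero_le_one (le_max_left _ _)

lemma clamp_eq {t : ℝ} (ht : t ∈ Set.Icc (0 : ℝ) 1) : min 1 (max 0 t) = t := by
  rw [max_eq_right ht.1, min_eq_right ht.2]

lemma norm_pt (n a : ℕ) {t : ℝ} (ht : t ∈ Set.Icc (0 : ℝ) 1) :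
    ‖(pt n (a, t) : ℂ)‖ = t := by
  rw [pt, norm_embC, clamp_eq ht]

lemma continuous_pt (n a : ℕ) : Continuous fun t : ℝ => pt n (a, t) := by
  unfold pt embC
  fun_prop

lemma embC_mod {n : ℕ} (hn : n ≠ 0) (k : ℕ) (t : ℝ) : embC n (k, t) = embC n (k % n, t) := by
  unfold embC
  congr 1
  rw [Complex.exp_eq_exp_iff_exists_int]
  refine ⟨(k / n : ℕ), ?_⟩
  have h : (k : ℂ) = (k % n : ℕ) + n * (k / n : ℕ) := by
    exact_mod_cast (Nat.mod_add_div k n).symm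
  have hn' : (n : ℂ) ≠ 0 := by exact_mod_cast hn
  simp only
  rw [h]
  simp only [Int.cast_natCast]
  field_simp

lemma embC_inj {n : ℕ} (hn : n ≠ 0) {k l : ℕ} {s t : ℝ} (h : embC n (k, s) = embC n (l, t)) :
    min 1 (max 0 s) = min 1 (max 0 t) ∧ (min 1 (max 0 t) = 0 ∨ k % n = l % n) := by
  have hs : min 1 (max 0 s) = min 1 (max 0 t) := by
    have := congrArg norm h
    rwa [norm_embC, norm_embC] at this
  refine ⟨hs, or_iff_not_imp_left.2 fun h0 => ?_⟩
  simp only [embC, hs] at h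
  have h1 := mul_left_cancel₀ (by exact_mod_cast h0) h
  rw [Complex.exp_eq_exp_iff_exists_int] at h1
  obtain ⟨m, hm⟩ := h1
  have hn' : (n : ℂ) ≠ 0 := by exact_mod_cast hn
  have hpi := Complex.two_pi_I_ne_zero
  have h2 : (k : ℂ) = l + m * n := by
    apply mul_left_cancel₀ hpi
    field_simp at hm
    linear_combination (2 * Real.pi * Complex.I) * hm
  have h3 : (k : ℤ) = l + m * n := by exact_mod_cast h2
  have h4 : ((k % n : ℕ) : ℤ) = (l % n : ℕ) := by
    push_cast
    rw [h3, Int.add_mul_emod_self_right]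
  exact_mod_cast h4

lemma exists_pt {n : ℕ} (hn : n ≠ 0) (z : Sspace n) :
    ∃ a < n, ∃ t ∈ Set.Icc (0 : ℝ) 1, z = pt n (a, t) := by
  obtain ⟨z, ⟨k, t⟩, rfl⟩ := z
  have ht : min 1 (max 0 t) ∈ Set.Icc (0 : ℝ) 1 :=
    ⟨le_min zero_le_one (le_max_left _ _), min_le_left _ _⟩
  refine ⟨k % n, Nat.mod_lt _ (Nat.pos_of_ne_zero hn), _, ht, Subtype.ext ?_⟩
  change embC n (k, t) = embC n (k % n, _)
  rw [← embC_mod hn]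
  unfold embC
  simp only [clamp_eq ht]

lemma pt_zero (n a b : ℕ) : pt n (a, 0) = pt n (b, 0) := by
  apply Subtype.ext
  simp [pt, embC]

lemma pt_inj {n : ℕ} (hn : n ≠ 0) {a b : ℕ} (ha : a < n) (hb : b < n) {s t : ℝ}
    (hs : s ∈ Set.Icc (0 : ℝ) 1) (ht : t ∈ Set.Icc (0 : ℝ) 1) (h : pt n (a, s) = pt n (b, t)) :
    s = t ∧ (t = 0 ∨ a = b) := by
  have h := embC_inj hn (congrArg Subtype.val h)
  rwa [clamp_eq hs, clamp_eq ht, Nat.mod_eq_of_lt ha, Nat.mod_eq_of_lt hb] at h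

/-- The ray of `S` with index `a`. -/
def ray (n a : ℕ) : Set (Sspace n) := (fun t : ℝ => pt n (a, t)) '' Set.Icc 0 1

lemma isClosed_ray (n a : ℕ) : IsClosed (ray n a) :=
  (isCompact_Icc.image (continuous_pt n a)).isClosed

/-- The union of all rays of `S` other than the one with index `a`. -/
def otherRays (n a : ℕ) : Set (Sspace n) := ⋃ b ∈ {b | b < n ∧ b ≠ a}, ray n b

lemma isClosed_otherRays (n a : ℕ) : IsClosed (otherRays n a) :=
  ((Set.finite_lt_nat n).subset fun _ h => h.1).isClosed_biUnion fun b _ => isClosed_ray n b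

lemma mem_ray_or {n : ℕ} (hn : n ≠ 0) (a : ℕ) (z : Sspace n) : z ∈ ray n a ∨ z ∈ otherRays n a := by
  obtain ⟨b, hb, t, ht, rfl⟩ := exists_pt hn z
  by_cases h : b = a
  · exact Or.inl ⟨t, ht, by rw [h]⟩
  · exact Or.inr (Set.mem_biUnion (show b ∈ {b | b < n ∧ b ≠ a} from ⟨hb, h⟩) ⟨t, ht, rfl⟩)

lemma eq_zero_of_mem {n : ℕ} (hn : n ≠ 0) {a : ℕ} (ha : a < n) {t : ℝ} (ht : t ∈ Set.Icc (0 : ℝ) 1)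
    (h : pt n (a, t) ∈ otherRays n a) : t = 0 := by
  simp only [otherRays, Set.mem_iUnion] at h
  obtain ⟨b, ⟨hb, hba⟩, s, hs, h⟩ := h
  obtain ⟨rfl, h | h⟩ := pt_inj hn hb ha hs ht h
  · exact h
  · exact absurd h hba

lemma subset_ray {n : ℕ} (hn : n ≠ 0) {B : Set (Sspace n)} (hB : IsConnected B)
    (h0 : pt n (0, 0) ∉ B) : ∃ a < n, B ⊆ ray n a := by
  obtain ⟨z, hz⟩ := hB.nonempty
  obtain ⟨a, ha, t, ht, rfl⟩ := exists_pt hn z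
  have ht0 : t ≠ 0 := fun h => h0 (by rw [← h, h, pt_zero n 0 a, ← h]; exact hz)
  have key : ∀ z ∈ B, z ∈ ray n a → z ∉ otherRays n a := by
    rintro _ hz ⟨s, hs, rfl⟩ h
    apply h0
    have := eq_zero_of_mem hn ha hs h
    rwa [pt_zero n 0 a, ← this]
  refine ⟨a, ha, fun z' hz' => ?_⟩
  by_contra hc
  obtain ⟨y, hy, hy1, hy2⟩ := hB.isPreconnected (otherRays n a)ᶜ (ray n a)ᶜ
    (isClosed_otherRays n a).isOpen_compl (isClosed_ray n a).isOpen_compl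
    (fun y hy => by
      by_cases h : y ∈ ray n a
      · exact Or.inl (key y hy h)
      · exact Or.inr h)
    ⟨_, hz, key _ hz ⟨t, ht, rfl⟩⟩ ⟨z', hz', hc⟩
  exact (mem_ray_or hn a y).elim hy2 hy1

lemma pt_mem_of_center {n : ℕ} (hn : n ≠ 0) {B : Set (Sspace n)} (hB : IsPreconnected B)
    (h0 : pt n (0, 0) ∈ B) {a : ℕ} (ha : a < n) {s t : ℝ} (hs : 0 ≤ s) (hst : s ≤ t) (ht : t ≤ 1)
    (h : pt n (a, t) ∈ B) : pt n (a, s) ∈ B := by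
  have htI : t ∈ Set.Icc (0 : ℝ) 1 := ⟨hs.trans hst, ht⟩
  have hsI : s ∈ Set.Icc (0 : ℝ) 1 := ⟨hs, hst.trans ht⟩
  by_contra hc
  have hs0 : 0 < s := hs.lt_of_ne fun h' => hc (by rw [← h', pt_zero n a 0]; exact h0)
  have hst' : s < t := hst.lt_of_ne fun h' => hc (by rw [h']; exact h)
  have hcont : Continuous fun z : Sspace n => ‖(z : ℂ)‖ := by fun_prop
  obtain ⟨y, hy, ⟨hy1, hy2⟩, hy3⟩ := hB ({z | s < ‖(z : ℂ)‖} ∩ (otherRays n a)ᶜ)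
    ({z | s ≤ ‖(z : ℂ)‖} ∩ ray n a)ᶜ
    ((isOpen_lt continuous_const hcont).inter (isClosed_otherRays n a).isOpen_compl)
    ((isClosed_le continuous_const hcont).inter (isClosed_ray n a)).isOpen_compl
    (fun y hy => by
      by_cases hyr : y ∈ {z : Sspace n | s ≤ ‖(z : ℂ)‖} ∩ ray n a
      · obtain ⟨hy1, r, hr, rfl⟩ := hyr
        left
        have hy1 : s ≤ ‖(pt n (a, r) : ℂ)‖ := hy1
        rw [norm_pt n a hr] at hy1
        have hsr : s < r := hy1.lt_of_ne fun h' => hc (by rw [h']; exact hy)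
        refine ⟨?_, fun hmem => ?_⟩
        · change s < ‖(pt n (a, r) : ℂ)‖
          rwa [norm_pt n a hr]
        · have := eq_zero_of_mem hn ha hr hmem
          linarith
      · exact Or.inr hyr)
    ⟨_, h, by
      refine ⟨?_, fun hmem => ?_⟩
      · change s < ‖(pt n (a, t) : ℂ)‖
        rwa [norm_pt n a htI]
      · have := eq_zero_of_mem hn ha htI hmem
        linarith⟩
    ⟨_, h0, by
      rintro ⟨hmem, -⟩
      change s ≤ ‖(pt n (0, 0) : ℂ)‖ at hmem
      rw [norm_pt n 0 (by simp)] at hmem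
      linarith⟩
  exact (mem_ray_or hn a y).elim (fun h => hy3 ⟨le_of_lt (show s < _ from hy1), h⟩) hy2

lemma pt_mem_of_subset_ray {n : ℕ} {B : Set (Sspace n)} (hB : IsPreconnected B)
    {a : ℕ} (hBa : B ⊆ ray n a) {r s t : ℝ} (hr : 0 ≤ r) (hrs : r ≤ s) (hst : s ≤ t)
    (ht : t ≤ 1) (h : pt n (a, r) ∈ B) (h' : pt n (a, t) ∈ B) : pt n (a, s) ∈ B := by
  have hcont : Continuous fun z : Sspace n => ‖(z : ℂ)‖ := by fun_prop
  have hp := (hB.image _ hcont.continuousOn).ordConnected.out ⟨_, h, rfl⟩ ⟨_, h', rfl⟩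
  simp only at hp
  rw [norm_pt n a ⟨hr, by linarith⟩, norm_pt n a ⟨by linarith, ht⟩] at hp
  obtain ⟨z, hz, hzs⟩ := hp ⟨hrs, hst⟩
  obtain ⟨u, hu, rfl⟩ := hBa hz
  simp only [norm_pt n a hu] at hzs
  rwa [← hzs]

/-- The number of edges of `X_1` on its arm `a`. -/
def len (n a : ℕ) : ℕ := if a = n - 2 then 2 else if a = n - 1 then 4 else 2 * n

/-- The piecewise affine parameter on arm `a` taking the value `j` at the `j`-th vertex of `X_1`. -/
noncomputable def par (n a : ℕ) (t : ℝ) : ℝ :=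
  if a = n then (if t ≤ 1 / 2 then (4 * (n : ℝ) - 2) * t else 2 * n - 2 + 2 * t)
  else if a = n - 1 then (if t ≤ 1 / 2 then 6 * t else 2 + 2 * t)
  else if a = n - 2 then 2 * t
  else 2 * n * t

lemma len_cases {n : ℕ} (hn : 3 ≤ n) (a : ℕ) :
    (a = n ∧ len n a = 2 * n) ∨ (a = n - 1 ∧ a ≠ n ∧ len n a = 4) ∨
    (a = n - 2 ∧ a ≠ n ∧ a ≠ n - 1 ∧ len n a = 2) ∨
    (a ≠ n ∧ a ≠ n - 1 ∧ a ≠ n - 2 ∧ len n a = 2 * n) := by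
  unfold len
  split_ifs <;> omega

lemma two_le_len {n : ℕ} (hn : 3 ≤ n) (a : ℕ) : 2 ≤ len n a := by
  have := len_cases hn a
  omega

lemma even_len {n : ℕ} (hn : 3 ≤ n) (a : ℕ) : Even (len n a) := by
  rw [Nat.even_iff]
  have := len_cases hn a
  omega

lemma min_floor_mem {m : ℕ} {x : ℝ} (h0 : 0 ≤ x) (h1 : x ≤ m + 1) :
    ((min m ⌊x⌋₊ : ℕ) : ℝ) ≤ x ∧ x ≤ (min m ⌊x⌋₊ : ℕ) + 1 := by
  have := Nat.floor_le h0
  have := (Nat.lt_floor_add_one x).le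
  push_cast
  refine ⟨(min_le_right _ _).trans ‹_›, ?_⟩
  rcases min_choice (m : ℝ) (⌊x⌋₊ : ℝ) with h | h <;> rw [h] <;> assumption

lemma segOf_spec {n : ℕ} (hn : 3 ≤ n) (a : ℕ) {t : ℝ} (ht : t ∈ Set.Icc (0 : ℝ) 1) :
    (segOf n a t).1 < len n a ∧ (segOf n a t).2 = par n a t - (segOf n a t).1 ∧
    ((segOf n a t).1 : ℝ) ≤ par n a t ∧ par n a t ≤ (segOf n a t).1 + 1 := by
  obtain ⟨ht0, ht1⟩ := ht
  have hn' : (3 : ℝ) ≤ n := by exact_mod_cast hn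
  rcases len_cases hn a with ⟨h1, hl⟩ | ⟨h2, h1, hl⟩ | ⟨h3, h1, h2, hl⟩ | ⟨h1, h2, h3, hl⟩
  · rw [hl]
    simp only [segOf, par, if_pos h1]
    split_ifs with hs
    · have := min_floor_mem (m := 2 * n - 2) (x := (4 * (n : ℝ) - 2) * t) (by nlinarith)
        (by rw [Nat.cast_sub (by omega)]; push_cast; nlinarith)
      exact ⟨by simp only; omega, rfl, this⟩
    · have : ((2 * n - 1 : ℕ) : ℝ) = 2 * n - 1 := by
        rw [Nat.cast_sub (by omega)]; push_cast; ring
      refine ⟨by simp only; omega, ?_, ?_, ?_⟩ <;> simp only [this] <;> linarith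
  · rw [hl]
    simp only [segOf, par, if_neg h1, if_pos h2]
    split_ifs with hs
    · have := min_floor_mem (m := 2) (x := 6 * t) (by linarith) (by push_cast; linarith)
      exact ⟨by simp only; omega, rfl, this⟩
    · refine ⟨by simp, ?_, ?_, ?_⟩ <;> push_cast <;> linarith
  · rw [hl]
    simp only [segOf, par, if_neg h1, if_neg h2, if_pos h3]
    have := min_floor_mem (m := 1) (x := 2 * t) (by linarith) (by push_cast; linarith)
    exact ⟨by omega, trivial, this⟩
  · rw [hl]
    simp only [segOf, par, if_neg h1, if_neg h2, if_neg h3]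
    have := min_floor_mem (m := 2 * n - 1) (x := 2 * (n : ℝ) * t) (by positivity)
      (by rw [Nat.cast_sub (by omega)]; push_cast; nlinarith)
    exact ⟨by omega, trivial, this⟩

lemma strictMono_par {n : ℕ} (hn : 3 ≤ n) (a : ℕ) : StrictMono (par n a) := by
  have hn' : (3 : ℝ) ≤ n := by exact_mod_cast hn
  intro s t hst
  unfold par
  split_ifs <;> nlinarith

lemma par_zero (n a : ℕ) : par n a 0 = 0 := by
  unfold par
  split_ifs <;> simp_all

lemma par_one {n : ℕ} (hn : 3 ≤ n) (a : ℕ) : par n a 1 = len n a := by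
  rcases len_cases hn a with ⟨h1, hl⟩ | ⟨h2, h1, hl⟩ | ⟨h3, h1, h2, hl⟩ | ⟨h1, h2, h3, hl⟩ <;>
    rw [hl] <;> unfold par
  · rw [if_pos h1]; norm_num
  · rw [if_neg h1, if_pos h2]; norm_num
  · rw [if_neg h1, if_neg h2, if_pos h3]; norm_num
  · rw [if_neg h1, if_neg h2, if_neg h3]; norm_num

lemma par_half_last (n : ℕ) : par n n (1 / 2) = 2 * n - 1 := by
  simp only [par, if_pos, le_refl]
  ring

lemma par_half_penultimate {n : ℕ} (hn : 3 ≤ n) : par n (n - 1) (1 / 2) = 3 := by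
  have : n - 1 ≠ n := by omega
  simp only [par, if_neg this, if_pos, le_refl]
  norm_num

lemma exists_par_eq {n : ℕ} (hn : 3 ≤ n) (a : ℕ) {p : ℝ} (h0 : 0 ≤ p) (h1 : p ≤ len n a) :
    ∃ t ∈ Set.Icc (0 : ℝ) 1, par n a t = p := by
  have hn' : (3 : ℝ) ≤ n := by exact_mod_cast hn
  have hc : Continuous (par n a) := by
    unfold par
    split_ifs
    · refine Continuous.if_le (by fun_prop) (by fun_prop) (by fun_prop) (by fun_prop) ?_
      intro t ht
      rw [ht]; ring
    · refine Continuous.if_le (by fun_prop) (by fun_prop) (by fun_prop) (by fun_prop) ?_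
      intro t ht
      rw [ht]; ring
    · fun_prop
    · fun_prop
  exact intermediate_value_Icc zero_le_one hc.continuousOn
    ⟨by rwa [par_zero], by rwa [par_one hn]⟩

lemma imgCoord_even {n : ℕ} (hn : 3 ≤ n) {a j : ℕ} (hj : Even j) (hjl : j + 2 ≤ len n a) :
    imgCoord n a j = (0, 0) := by
  rw [Nat.even_iff] at hj
  rcases len_cases hn a with ⟨h1, hl⟩ | ⟨h2, h1, hl⟩ | ⟨h3, h1, h2, hl⟩ | ⟨h1, h2, h3, hl⟩ <;>
    rw [hl] at hjl <;> unfold imgCoord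
  · simp only [if_pos h1]
    split_ifs <;> first | contradiction | rfl | omega
  · simp only [if_neg h1, if_pos h2]
    split_ifs <;> first | contradiction | rfl | omega
  · simp only [if_neg h1, if_neg h2, if_pos h3]
    split_ifs <;> first | contradiction | rfl | omega
  · simp only [if_neg h1, if_neg h2, if_neg h3]
    split_ifs <;> first | contradiction | rfl | omega

lemma imgCoord_one {n : ℕ} (hn : 3 ≤ n) (a : ℕ) : imgCoord n a 1 = vcoord n (n - 1) := by
  unfold imgCoord
  split_ifs <;> first | contradiction | rfl | omega

lemma imgCoord_len {n : ℕ} (hn : 3 ≤ n) (a : ℕ) :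
    (imgCoord n a (len n a - 1) = vcoord n (n - 1) ∧ imgCoord n a (len n a) = vcoord n (n + 1)) ∨
    (imgCoord n a (len n a - 1) = vcoord n n ∧ imgCoord n a (len n a) = vcoord n (n + 2)) := by
  rcases len_cases hn a with ⟨h1, hl⟩ | ⟨h2, h1, hl⟩ | ⟨h3, h1, h2, hl⟩ | ⟨h1, h2, h3, hl⟩ <;>
    rw [hl] <;> unfold imgCoord
  · right
    constructor <;> simp only [if_pos h1] <;> split_ifs <;> first | contradiction | rfl | omega
  · right
    constructor <;> simp only [if_neg h1, if_pos h2] <;> split_ifs <;> first | contradiction | rfl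
  · left
    constructor <;> simp only [if_neg h1, if_neg h2, if_pos h3] <;> split_ifs <;>
      first | contradiction | rfl
  · right
    constructor <;> simp only [if_neg h1, if_neg h2, if_neg h3] <;> split_ifs <;>
      first | contradiction | rfl | omega

lemma imgCoord_odd {n : ℕ} (hn : 3 ≤ n) {a j : ℕ} (hj : Odd j) (hjl : j < len n a) :
    ∃ i, 1 ≤ i ∧ i ≤ n + 2 ∧ imgCoord n a j = vcoord n i := by
  rw [Nat.odd_iff] at hj
  rcases len_cases hn a with ⟨h1, hl⟩ | ⟨h2, h1, hl⟩ | ⟨h3, h1, h2, hl⟩ | ⟨h1, h2, h3, hl⟩ <;>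
    rw [hl] at hjl <;> unfold imgCoord
  · simp only [if_pos h1]
    split_ifs <;> first | contradiction | omega | exact ⟨_, by omega, by omega, rfl⟩
  · simp only [if_neg h1, if_pos h2]
    split_ifs <;> first | contradiction | omega | exact ⟨_, by omega, by omega, rfl⟩
  · simp only [if_neg h1, if_neg h2, if_pos h3]
    split_ifs <;> first | contradiction | omega | exact ⟨_, by omega, by omega, rfl⟩
  · simp only [if_neg h1, if_neg h2, if_neg h3]
    have : (a + (j - 1) / 2 - 2) % (n - 2) < n - 2 := Nat.mod_lt _ (by omega)
    split_ifs <;> first | contradiction | omega | exact ⟨_, by omega, by omega, rfl⟩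

/-- Every nonzero vertex of `X_0` is a midpoint of one of the last two rays or a tip. -/
lemma vcoord_cases {n : ℕ} (hn : 3 ≤ n) {i : ℕ} (h1 : 1 ≤ i) :
    vcoord n i = (n - 2, 1 / 2) ∨ vcoord n i = (n - 1, 1 / 2) ∨ ∃ a < n, vcoord n i = (a, 1) := by
  unfold vcoord
  split_ifs
  · omega
  · exact Or.inr (Or.inr ⟨_, by omega, rfl⟩)
  · exact Or.inl rfl
  · exact Or.inr (Or.inl rfl)
  · exact Or.inr (Or.inr ⟨_, by omega, rfl⟩)
  · exact Or.inr (Or.inr ⟨_, by omega, rfl⟩)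

lemma vcoord_pos {n : ℕ} (hn : 3 ≤ n) {i : ℕ} (h1 : 1 ≤ i) :
    0 < (vcoord n i).2 ∧ (vcoord n i).2 ≤ 1 := by
  rcases vcoord_cases hn h1 with h | h | ⟨a, -, h⟩ <;> rw [h] <;> norm_num

lemma vcoord_tip {n a : ℕ} (ha : a < n - 2) : vcoord n (a + 1) = (a, 1) := by
  unfold vcoord
  split_ifs <;> first | contradiction | omega | rfl

lemma vcoord_pred {n : ℕ} (hn : 3 ≤ n) : vcoord n (n - 1) = (n - 2, 1 / 2) := by
  unfold vcoord
  split_ifs <;> first | contradiction | omega | rfl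

lemma vcoord_self {n : ℕ} (hn : 3 ≤ n) : vcoord n n = (n - 1, 1 / 2) := by
  unfold vcoord
  split_ifs <;> first | contradiction | omega | rfl

lemma vcoord_succ {n : ℕ} (hn : 3 ≤ n) : vcoord n (n + 1) = (n - 2, 1) := by
  unfold vcoord
  split_ifs <;> first | contradiction | omega | rfl

lemma vcoord_add_two {n : ℕ} (hn : 3 ≤ n) : vcoord n (n + 2) = (n - 1, 1) := by
  unfold vcoord
  split_ifs <;> first | contradiction | omega | rfl

/-- The image under `φ` of a point of the `j`-th edge of `X_1` on arm `a`, in arm coordinates. -/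
lemma fS_pt {n : ℕ} (hn : 3 ≤ n) {r : ℕ} (hr : r < n) {t : ℝ} (ht : t ∈ Set.Icc (0 : ℝ) 1) :
    ∃ j < len n (r + 1), (j : ℝ) ≤ par n (r + 1) t ∧ par n (r + 1) t ≤ j + 1 ∧
      fS n (pt n (r, t)) = pt n (interpC (imgCoord n (r + 1) j) (imgCoord n (r + 1) (j + 1))
        (par n (r + 1) t - j)) := by
  have hn0 : n ≠ 0 := by omega
  set q := Function.invFun (embC n) (embC n (r, t)) with hq
  have hqe : embC n (q.1, q.2) = embC n (r, t) := Function.invFun_eq ⟨_, rfl⟩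
  have hf : fS n (pt n (r, t)) = pt n (Gmap n q) := rfl
  obtain ⟨h1, h2⟩ := embC_inj hn0 hqe
  rw [clamp_eq ht] at h1 h2
  rw [Nat.mod_eq_of_lt hr] at h2
  have hG : ∀ b, q.1 % n = b → fS n (pt n (r, t)) = pt n (interpC
      (imgCoord n (b + 1) (segOf n (b + 1) t).1) (imgCoord n (b + 1) ((segOf n (b + 1) t).1 + 1))
      (segOf n (b + 1) t).2) := by
    rintro b rfl
    rw [hf, Gmap, h1]
  rcases h2 with rfl | h2
  · refine ⟨0, lt_of_lt_of_le two_pos (two_le_len hn _), by simp [par_zero], by simp [par_zero], ?_⟩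
    have hev : ∀ b, imgCoord n b 0 = (0, 0) := fun b =>
      imgCoord_even hn (by simp) (by simpa using two_le_len hn b)
    obtain ⟨-, h3, h4, -⟩ := segOf_spec hn (q.1 % n + 1) ht
    rw [par_zero] at h3 h4
    have h5 : (segOf n (q.1 % n + 1) 0).1 = 0 := by
      have : (0 : ℝ) ≤ (segOf n (q.1 % n + 1) 0).1 := Nat.cast_nonneg _
      exact_mod_cast le_antisymm h4 this
    rw [h5] at h3
    rw [hG _ rfl, h5, h3, hev, hev, par_zero]
    simp only [interpC, Nat.cast_zero, sub_zero, mul_zero, zero_mul, add_zero]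
    exact pt_zero _ _ _
  · obtain ⟨h3, h4, h5, h6⟩ := segOf_spec hn (r + 1) ht
    exact ⟨_, h3, h5, h6, by rw [hG r h2, h4]⟩

lemma imgCoord_mem {n : ℕ} (hn : 3 ≤ n) {a j : ℕ} (hj : j ≤ len n a) :
    (imgCoord n a j).2 ∈ Set.Icc (0 : ℝ) 1 := by
  rcases hj.eq_or_lt with rfl | hj
  · rcases imgCoord_len hn a with ⟨-, h⟩ | ⟨-, h⟩ <;> rw [h]
    · exact ⟨(vcoord_pos hn (by omega)).1.le, (vcoord_pos hn (by omega)).2⟩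
    · exact ⟨(vcoord_pos hn (by omega)).1.le, (vcoord_pos hn (by omega)).2⟩
  · rcases Nat.even_or_odd j with he | ho
    · rw [imgCoord_even hn he]
      · simp
      · have h := even_len hn a
        rw [Nat.even_iff] at h he
        omega
    · obtain ⟨i, hi, -, h⟩ := imgCoord_odd hn ho hj
      rw [h]
      exact ⟨(vcoord_pos hn hi).1.le, (vcoord_pos hn hi).2⟩

lemma norm_fS {n : ℕ} (hn : 3 ≤ n) {r : ℕ} (hr : r < n) {t : ℝ} (ht : t ∈ Set.Icc (0 : ℝ) 1)
    {j : ℕ} (hj : j < len n (r + 1)) (h1 : (j : ℝ) ≤ par n (r + 1) t)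
    (h2 : par n (r + 1) t ≤ j + 1) :
    ‖(fS n (pt n (r, t)) : ℂ)‖ = (1 - (par n (r + 1) t - j)) * (imgCoord n (r + 1) j).2
      + (par n (r + 1) t - j) * (imgCoord n (r + 1) (j + 1)).2 := by
  obtain ⟨i, hi, h3, h4, h⟩ := fS_pt hn hr ht
  have m1 := imgCoord_mem hn hi.le
  have m2 := imgCoord_mem hn (Nat.succ_le_of_lt hi)
  rw [h]
  unfold interpC
  rw [norm_pt]
  · have hij : i < j + 2 := by
      have : (i : ℝ) < (j + 2 : ℕ) := by push_cast; linarith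
      exact_mod_cast this
    have hji : j < i + 2 := by
      have : (j : ℝ) < (i + 2 : ℕ) := by push_cast; linarith
      exact_mod_cast this
    obtain rfl | rfl | rfl : i = j ∨ i = j + 1 ∨ j = i + 1 := by omega
    · rfl
    · have : par n (r + 1) t = j + 1 := le_antisymm h2 (by exact_mod_cast h3)
      rw [this]
      push_cast
      ring
    · have : par n (r + 1) t = i + 1 := le_antisymm h4 (by exact_mod_cast h1)
      rw [this]
      push_cast
      ring
  · have hs0 := sub_nonneg.2 h3
    have hs1 : par n (r + 1) t - i ≤ 1 := by linarith
    have hs2 := sub_nonneg.2 hs1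
    exact (convex_Icc (0 : ℝ) 1) m1 m2 hs2 hs0 (by ring)

lemma imgCoord_edge {n : ℕ} (hn : 3 ≤ n) {a j : ℕ} (hj : j < len n a) :
    (imgCoord n a j).2 ≠ (imgCoord n a (j + 1)).2 := by
  have he := even_len hn a
  rw [Nat.even_iff] at he
  rcases Nat.even_or_odd j with hje | hjo
  · have hje' := Nat.even_iff.1 hje
    obtain ⟨i, hi, -, h⟩ := imgCoord_odd hn hje.add_one (show j + 1 < len n a by omega)
    rw [imgCoord_even hn hje (by omega), h]
    exact (vcoord_pos hn hi).1.ne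
  · have hjo' := Nat.odd_iff.1 hjo
    by_cases hl : j + 1 = len n a
    · obtain rfl : j = len n a - 1 := by omega
      rw [hl]
      rcases imgCoord_len hn a with ⟨h, h'⟩ | ⟨h, h'⟩ <;> rw [h, h']
      · rw [vcoord_pred hn, vcoord_succ hn]; norm_num
      · rw [vcoord_self hn, vcoord_add_two hn]; norm_num
    · obtain ⟨i, hi, -, h⟩ := imgCoord_odd hn hjo hj
      rw [imgCoord_even hn hjo.add_one (by omega), h]
      exact (vcoord_pos hn hi).1.ne'

/-- `φ` is injective on each edge of `X_1`. -/
lemma fS_inj_edge {n : ℕ} (hn : 3 ≤ n) {r : ℕ} (hr : r < n) {s t : ℝ}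
    (hs : s ∈ Set.Icc (0 : ℝ) 1) (ht : t ∈ Set.Icc (0 : ℝ) 1)
    {j : ℕ} (hj : j < len n (r + 1)) (h1 : (j : ℝ) ≤ par n (r + 1) s)
    (h2 : par n (r + 1) s ≤ j + 1) (h3 : (j : ℝ) ≤ par n (r + 1) t)
    (h4 : par n (r + 1) t ≤ j + 1) (h : fS n (pt n (r, s)) = fS n (pt n (r, t))) : s = t := by
  have h := congrArg (fun z : Sspace n => ‖(z : ℂ)‖) h
  simp only [norm_fS hn hr hs hj h1 h2, norm_fS hn hr ht hj h3 h4] at h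
  have h5 : (par n (r + 1) s - par n (r + 1) t) *
      ((imgCoord n (r + 1) (j + 1)).2 - (imgCoord n (r + 1) j).2) = 0 := by linear_combination h
  rcases mul_eq_zero.1 h5 with h5 | h5
  · exact (strictMono_par hn _).injective (sub_eq_zero.1 h5)
  · exact absurd (sub_eq_zero.1 h5).symm (imgCoord_edge hn hj)

/-- `φ` is injective on the outermost two edges of each arm of `X_1`. -/
lemma fS_inj_outer {n : ℕ} (hn : 3 ≤ n) {r : ℕ} (hr : r < n) {s t : ℝ}
    (hs : s ∈ Set.Icc (0 : ℝ) 1) (ht : t ∈ Set.Icc (0 : ℝ) 1)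
    (h1 : (len n (r + 1) : ℝ) - 2 ≤ par n (r + 1) s)
    (h2 : (len n (r + 1) : ℝ) - 2 ≤ par n (r + 1) t)
    (h : fS n (pt n (r, s)) = fS n (pt n (r, t))) : s = t := by
  have hl := two_le_len hn (r + 1)
  obtain ⟨m, hm⟩ : ∃ m, len n (r + 1) = m + 2 := ⟨_, (Nat.sub_add_cancel hl).symm⟩
  have hme : Even m := by
    have := even_len hn (r + 1)
    rw [Nat.even_iff] at this ⊢
    omega
  have c0 : (imgCoord n (r + 1) m).2 = 0 := by rw [imgCoord_even hn hme hm.ge]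
  have c1 : (imgCoord n (r + 1) (m + 1)).2 = 1 / 2 ∧ (imgCoord n (r + 1) (m + 1 + 1)).2 = 1 := by
    rcases imgCoord_len hn (r + 1) with ⟨h, h'⟩ | ⟨h, h'⟩ <;> rw [hm] at h h' <;>
      simp only [Nat.add_succ_sub_one] at h <;> rw [h, h']
    · rw [vcoord_pred hn, vcoord_succ hn]; simp
    · rw [vcoord_self hn, vcoord_add_two hn]; simp
  have key : ∀ t ∈ Set.Icc (0 : ℝ) 1, (len n (r + 1) : ℝ) - 2 ≤ par n (r + 1) t →
      ‖(fS n (pt n (r, t)) : ℂ)‖ = (par n (r + 1) t - m) / 2 := by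
    intro t ht h
    have hu : par n (r + 1) t ≤ len n (r + 1) := by
      rw [← par_one hn]
      exact (strictMono_par hn _).monotone ht.2
    rw [hm] at h hu
    push_cast at h hu
    rcases le_total (par n (r + 1) t) (m + 1) with h' | h'
    · rw [norm_fS hn hr ht (j := m) (by omega) (by linarith) h', c0, c1.1]
      ring
    · rw [norm_fS hn hr ht (j := m + 1) (by omega) (by push_cast; linarith)
        (by push_cast; linarith), c1.1, c1.2]
      push_cast
      ring
  have h := congrArg (fun z : Sspace n => ‖(z : ℂ)‖) h
  simp only [key s hs h1, key t ht h2] at h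
  exact (strictMono_par hn (r + 1)).injective (by linarith)

/-- `φ` maps the `j`-th vertex of each arm of `X_1` as prescribed by the table. -/
lemma fS_vertex {n : ℕ} (hn : 3 ≤ n) {r : ℕ} (hr : r < n) {t : ℝ} (ht : t ∈ Set.Icc (0 : ℝ) 1)
    {j : ℕ} (h : par n (r + 1) t = j) : fS n (pt n (r, t)) = pt n (imgCoord n (r + 1) j) := by
  obtain ⟨i, hi, h3, h4, hf⟩ := fS_pt hn hr ht
  rw [h] at h3 h4 hf
  have h3 : i ≤ j := by exact_mod_cast h3
  have h4 : j ≤ i + 1 := by exact_mod_cast h4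
  rw [hf]
  obtain rfl | rfl : j = i ∨ j = i + 1 := by omega
  · rw [sub_self]
    unfold interpC
    simp only [sub_zero, one_mul, zero_mul, add_zero]
    split_ifs with h0
    · rw [h0, pt_zero n _ (imgCoord n (r + 1) j).1]
      conv_rhs => rw [← Prod.mk.eta (p := imgCoord n (r + 1) j), h0]
    · rfl
  · unfold interpC
    push_cast
    simp only [add_sub_cancel_left, sub_self, zero_mul, one_mul, zero_add]
    split_ifs with h0
    · rfl
    · have he := even_len hn (r + 1)
      have hio : Odd i := by
        by_contra hie
        rw [Nat.not_odd_iff_even] at hie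
        rw [Nat.even_iff] at he
        have := Nat.even_iff.1 hie
        exact h0 (by rw [imgCoord_even hn hie (by omega)])
      have hio' := Nat.odd_iff.1 hio
      rw [Nat.even_iff] at he
      by_cases hl : i + 1 = len n (r + 1)
      · rw [hl]
        obtain rfl : i = len n (r + 1) - 1 := by omega
        rcases imgCoord_len hn (r + 1) with ⟨h, h'⟩ | ⟨h, h'⟩ <;> rw [h, h']
        · rw [vcoord_pred hn, vcoord_succ hn]
        · rw [vcoord_self hn, vcoord_add_two hn]
      · rw [imgCoord_even hn hio.add_one (by omega)]
        exact pt_zero _ _ _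

lemma fS_half_last {n : ℕ} (hn : 3 ≤ n) : fS n (pt n (n - 1, 1 / 2)) = pt n (n - 1, 1 / 2) := by
  have e : n - 1 + 1 = n := by omega
  rw [fS_vertex hn (by omega) (by norm_num) (j := 2 * n - 1)
    (by rw [e, par_half_last, Nat.cast_sub (by omega)]; simp)]
  rw [e, ← vcoord_self hn]
  congr 1
  unfold imgCoord
  simp only [if_true]
  split_ifs <;> first | omega | rfl

lemma fS_half_penultimate {n : ℕ} (hn : 3 ≤ n) :
    fS n (pt n (n - 2, 1 / 2)) = pt n (n - 1, 1 / 2) := by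
  have e : n - 2 + 1 = n - 1 := by omega
  rw [fS_vertex hn (by omega) (by norm_num) (j := 3) (by rw [e, par_half_penultimate hn]; simp),
    e, ← vcoord_self hn]
  congr 1
  unfold imgCoord
  split_ifs <;> first | contradiction | omega | rfl

lemma fS_tip {n : ℕ} (hn : 3 ≤ n) {r : ℕ} (hr : r < n) :
    fS n (pt n (r, 1)) = pt n (n - 2, 1) ∨ fS n (pt n (r, 1)) = pt n (n - 1, 1) := by
  rw [fS_vertex hn hr (by norm_num) (par_one hn _), ← vcoord_succ hn, ← vcoord_add_two hn]
  exact (imgCoord_len hn (r + 1)).imp (fun h => by rw [h.2]) (fun h => by rw [h.2])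

/-- The vertices of `X_0` other than the branch point. -/
def outerVertices (n : ℕ) : Set (Sspace n) :=
  {z | z = pt n (n - 2, 1 / 2) ∨ z = pt n (n - 1, 1 / 2) ∨ ∃ a < n, z = pt n (a, 1)}

lemma fS_mem_outerVertices {n : ℕ} (hn : 3 ≤ n) {z : Sspace n} (hz : z ∈ outerVertices n) :
    fS n z ∈ outerVertices n := by
  rcases hz with rfl | rfl | ⟨a, ha, rfl⟩
  · exact Or.inr (Or.inl (fS_half_penultimate hn))
  · exact Or.inr (Or.inl (fS_half_last hn))
  · rcases fS_tip hn ha with h | h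
    · exact Or.inr (Or.inr ⟨n - 2, by omega, h⟩)
    · exact Or.inr (Or.inr ⟨n - 1, by omega, h⟩)

lemma outerVertices_spec {n : ℕ} (hn : 3 ≤ n) {z : Sspace n} (hz : z ∈ outerVertices n) :
    ∃ a < n, ∃ t ∈ Set.Icc (0 : ℝ) 1, z = pt n (a, t) ∧
      (len n (a + 1) : ℝ) - 1 ≤ par n (a + 1) t := by
  rcases hz with rfl | rfl | ⟨a, ha, rfl⟩
  · refine ⟨n - 2, by omega, _, by norm_num, rfl, ?_⟩
    have e : n - 2 + 1 = n - 1 := by omega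
    have hl : len n (n - 1) = 4 := by have := len_cases hn (n - 1); omega
    rw [e, par_half_penultimate hn, hl]
    norm_num
  · refine ⟨n - 1, by omega, _, by norm_num, rfl, ?_⟩
    have e : n - 1 + 1 = n := by omega
    have hl : len n n = 2 * n := by have := len_cases hn n; omega
    rw [e, par_half_last, hl]
    push_cast
    rfl
  · exact ⟨a, ha, 1, by norm_num, rfl, by rw [par_one hn]; linarith⟩

lemma vcoord_mem_outerVertices {n : ℕ} (hn : 3 ≤ n) {i : ℕ} (hi : 1 ≤ i) :
    pt n (vcoord n i) ∈ outerVertices n := by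
  rcases vcoord_cases hn hi with h | h | ⟨a, ha, h⟩ <;> rw [h]
  · exact Or.inl rfl
  · exact Or.inr (Or.inl rfl)
  · exact Or.inr (Or.inr ⟨a, ha, rfl⟩)

/-- If `φ` folds a connected subset of an arm avoiding the preimages of the branch point, then this
set contains a folding point, and it contains no vertex of `X_0`. -/
lemma fold_spec {n : ℕ} (hn : 3 ≤ n) {B : Set (Sspace n)} (hB : IsPreconnected B) {r : ℕ}
    (hr : r < n) (hBr : B ⊆ ray n r) (hz : ∀ z ∈ B, fS n z ≠ pt n (0, 0))
    (hinj : ¬ Set.InjOn (fS n) B) :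
    (∃ p ∈ B, fS n p ∈ outerVertices n) ∧ ∀ z ∈ outerVertices n, z ∉ B := by
  have hmono := strictMono_par hn (r + 1)
  obtain ⟨s, hs, t, ht, hst, hsB, htB, hf⟩ : ∃ s ∈ Set.Icc (0 : ℝ) 1, ∃ t ∈ Set.Icc (0 : ℝ) 1,
      s < t ∧ pt n (r, s) ∈ B ∧ pt n (r, t) ∈ B ∧ fS n (pt n (r, s)) = fS n (pt n (r, t)) := by
    simp only [Set.InjOn, not_forall] at hinj
    obtain ⟨x, hx, y, hy, hxy, hne⟩ := hinj
    obtain ⟨s, hs, rfl⟩ := hBr hx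
    obtain ⟨t, ht, rfl⟩ := hBr hy
    rcases lt_trichotomy s t with h | rfl | h
    · exact ⟨s, hs, t, ht, h, hx, hy, hxy⟩
    · exact absurd rfl hne
    · exact ⟨t, ht, s, hs, h, hy, hx, hxy.symm⟩
  have hpar0 : ∀ t ∈ Set.Icc (0 : ℝ) 1, 0 ≤ par n (r + 1) t := fun t ht => by
    rw [← par_zero n (r + 1)]; exact hmono.monotone ht.1
  have hpar1 : ∀ t ∈ Set.Icc (0 : ℝ) 1, par n (r + 1) t ≤ len n (r + 1) := fun t ht => by
    rw [← par_one hn (r + 1)]; exact hmono.monotone ht.2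
  have between : ∀ u ∈ Set.Icc (0 : ℝ) 1, ∀ v ∈ Set.Icc (0 : ℝ) 1, pt n (r, u) ∈ B →
      pt n (r, v) ∈ B → ∀ p : ℝ, par n (r + 1) u ≤ p → p ≤ par n (r + 1) v →
      ∃ w ∈ Set.Icc (0 : ℝ) 1, pt n (r, w) ∈ B ∧ par n (r + 1) w = p := by
    intro u hu v hv huB hvB p hp1 hp2
    obtain ⟨w, hw, rfl⟩ := exists_par_eq hn (r + 1) ((hpar0 u hu).trans hp1)
      (hp2.trans (hpar1 v hv))
    exact ⟨w, hw, pt_mem_of_subset_ray hB hBr hu.1 (hmono.le_iff_le.1 hp1)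
      (hmono.le_iff_le.1 hp2) hv.2 huB hvB, rfl⟩
  have avoid : ∀ u ∈ Set.Icc (0 : ℝ) 1, ∀ v ∈ Set.Icc (0 : ℝ) 1, pt n (r, u) ∈ B →
      pt n (r, v) ∈ B → ∀ i : ℕ, Even i → i + 2 ≤ len n (r + 1) →
      par n (r + 1) u ≤ i → par n (r + 1) v < i := by
    intro u hu v hv huB hvB i hie hil hui
    by_contra hc
    obtain ⟨w, hw, hwB, hwp⟩ := between u hu v hv huB hvB i hui (not_lt.1 hc)
    apply hz _ hwB
    rw [fS_vertex hn hr hw hwp, imgCoord_even hn hie hil]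
  obtain ⟨m, hm⟩ : ∃ m, len n (r + 1) = m + 2 :=
    ⟨_, (Nat.sub_add_cancel (two_le_len hn (r + 1))).symm⟩
  have hme : m % 2 = 0 := by
    have := even_len hn (r + 1)
    rw [Nat.even_iff] at this
    omega
  have hsm : par n (r + 1) s < m := by
    by_contra hc
    have hc := not_lt.1 hc
    have := hmono hst
    refine hst.ne (fS_inj_outer hn hr hs ht ?_ ?_ hf) <;> rw [hm] <;> push_cast <;> linarith
  obtain ⟨i, hie, hi1, hi2⟩ : ∃ i : ℕ, i % 2 = 0 ∧ (i : ℝ) ≤ par n (r + 1) s ∧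
      par n (r + 1) s < i + 2 := by
    refine ⟨2 * ⌊par n (r + 1) s / 2⌋₊, by omega, ?_, ?_⟩
    · have := Nat.floor_le (show 0 ≤ par n (r + 1) s / 2 by have := hpar0 s hs; positivity)
      push_cast
      linarith
    · have := Nat.lt_floor_add_one (par n (r + 1) s / 2)
      push_cast
      linarith
  have him : i < m := by
    have : (i : ℝ) < m := hi1.trans_lt hsm
    exact_mod_cast this
  have hti : par n (r + 1) t < i + 2 := by
    have := avoid s hs t ht hsB htB (i + 2) (Nat.even_iff.2 (by omega)) (by omega)
      (by push_cast; exact hi2.le)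
    exact_mod_cast this
  have hst' := hmono hst
  have hs1 : par n (r + 1) s < i + 1 := by
    by_contra hc
    have hc := not_lt.1 hc
    exact hst.ne (fS_inj_edge hn hr hs ht (j := i + 1) (by omega) (by push_cast; exact hc)
      (by push_cast; linarith) (by push_cast; linarith) (by push_cast; linarith) hf)
  have ht1 : (i : ℝ) + 1 < par n (r + 1) t := by
    by_contra hc
    have hc := not_lt.1 hc
    exact hst.ne (fS_inj_edge hn hr hs ht (j := i) (by omega) hi1 hs1.le (by linarith) hc hf)
  constructor
  · obtain ⟨w, hw, hwB, hwp⟩ := between s hs t ht hsB htB (i + 1) hs1.le ht1.le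
    refine ⟨_, hwB, ?_⟩
    obtain ⟨k, hk, -, hik⟩ := imgCoord_odd hn (a := r + 1) (j := i + 1)
      (Nat.odd_iff.2 (by omega)) (by omega)
    rw [fS_vertex hn hr hw (j := i + 1) (by push_cast; exact hwp), hik]
    exact vcoord_mem_outerVertices hn hk
  · intro z hzW hzB
    obtain ⟨a, ha, v, hv, rfl, hl⟩ := outerVertices_spec hn hzW
    obtain ⟨u, hu, huv⟩ := hBr hzB
    obtain ⟨rfl, h0 | rfl⟩ := pt_inj (by omega) hr ha hu hv huv
    · subst h0
      rw [par_zero] at hl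
      have : (2 : ℝ) ≤ len n (a + 1) := by exact_mod_cast two_le_len hn (a + 1)
      linarith
    · have := avoid s hs u hu hsB hzB m (Nat.even_iff.2 hme) (by omega) hsm.le
      rw [hm] at hl
      push_cast at hl
      linarith

lemma fS_center {n : ℕ} (hn : 3 ≤ n) : fS n (pt n (0, 0)) = pt n (0, 0) := by
  rw [fS_vertex hn (by omega) (by norm_num) (j := 0) (by simp [par_zero]),
    imgCoord_even hn (by simp) (by simpa using two_le_len hn _)]

lemma fS_tip_antepenultimate {n : ℕ} (hn : 3 ≤ n) : fS n (pt n (n - 3, 1)) = pt n (n - 2, 1) := by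
  have e : n - 3 + 1 = n - 2 := by omega
  have hl : len n (n - 2) = 2 := by have := len_cases hn (n - 2); omega
  rw [fS_vertex hn (by omega) (by norm_num) (par_one hn _), e, hl, ← vcoord_succ hn]
  congr 1
  unfold imgCoord
  split_ifs <;> first | contradiction | omega | rfl

lemma fS_tip_penultimate {n : ℕ} (hn : 3 ≤ n) : fS n (pt n (n - 2, 1)) = pt n (n - 1, 1) := by
  have e : n - 2 + 1 = n - 1 := by omega
  have hl : len n (n - 1) = 4 := by have := len_cases hn (n - 1); omega
  rw [fS_vertex hn (by omega) (by norm_num) (par_one hn _), e, hl, ← vcoord_add_two hn]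
  congr 1
  unfold imgCoord
  split_ifs <;> first | contradiction | omega | rfl

lemma exists_imgCoord_eq_tip {n : ℕ} (hn : 3 ≤ n) {a : ℕ} (ha : a < n - 2) :
    ∃ j ≤ 2 * n - 1, imgCoord n n j = (a, 1) := by
  rw [← vcoord_tip ha]
  by_cases h : a = n - 3
  · refine ⟨3, by omega, ?_⟩
    subst h
    have e : n - 3 + 1 = n - 2 := by omega
    rw [e]
    unfold imgCoord
    simp only [if_true]
    split_ifs <;> first | contradiction | omega | rfl
  · refine ⟨2 * a + 5, by omega, ?_⟩
    unfold imgCoord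
    simp only [if_true]
    split_ifs <;> first | contradiction | omega | skip
    congr 1
    omega

/-- A connected set containing the branch point and a point at least one edge of `X_1` away from it
is mapped onto `S` by the fifth iterate of `φ`. -/
lemma eq_univ_of_far {n : ℕ} (hn : 3 ≤ n) {C : ℕ → Set (Sspace n)} (hC : ∀ k, IsPreconnected (C k))
    (hf : ∀ k, Set.MapsTo (fS n) (C (k + 1)) (C k)) (h0 : ∀ k, pt n (0, 0) ∈ C k) {k a : ℕ}
    (ha : a < n) {t : ℝ} (ht : t ∈ Set.Icc (0 : ℝ) 1) (hp : 1 ≤ par n (a + 1) t)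
    (h : pt n (a, t) ∈ C (k + 5)) : C k = Set.univ := by
  have hn0 : n ≠ 0 := by omega
  have c4 : pt n (n - 2, 1 / 2) ∈ C (k + 4) := by
    have hl : (2 : ℝ) ≤ len n (a + 1) := by exact_mod_cast two_le_len hn (a + 1)
    obtain ⟨s, hs, hsp⟩ := exists_par_eq hn (a + 1) zero_le_one (by linarith)
    have hst : s ≤ t := (strictMono_par hn (a + 1)).le_iff_le.1 (by rw [hsp]; exact hp)
    have := hf (k + 4) (pt_mem_of_center hn0 (hC _) (h0 _) ha hs.1 hst ht.2 h)
    rwa [fS_vertex hn ha hs (j := 1) (by rw [hsp]; simp), imgCoord_one hn, vcoord_pred hn] at this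
  have c3 : pt n (n - 1, 1 / 2) ∈ C (k + 3) := fS_half_penultimate hn ▸ hf (k + 3) c4
  have step : ∀ j, pt n (n - 1, 1 / 2) ∈ C (j + 1) →
      pt n (n - 1, 1 / 2) ∈ C j ∧ ∀ b < n - 2, pt n (b, 1) ∈ C j := by
    intro j hj
    refine ⟨fS_half_last hn ▸ hf j hj, fun b hb => ?_⟩
    obtain ⟨i, hi, hib⟩ := exists_imgCoord_eq_tip hn hb
    have hl : len n n = 2 * n := by have := len_cases hn n; omega
    have hi' : (i : ℝ) ≤ 2 * n - 1 := by
      have : (i : ℝ) ≤ (2 * n - 1 : ℕ) := by exact_mod_cast hi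
      rw [Nat.cast_sub (by omega)] at this
      exact_mod_cast this
    have e : n - 1 + 1 = n := by omega
    obtain ⟨s, hs, hsp⟩ := exists_par_eq hn n (Nat.cast_nonneg i)
      (by rw [hl]; push_cast; linarith)
    have hst : s ≤ 1 / 2 :=
      (strictMono_par hn n).le_iff_le.1 (by rw [hsp, par_half_last]; exact hi')
    have := hf j (pt_mem_of_center hn0 (hC _) (h0 _) (by omega) hs.1 hst (by norm_num) hj)
    rwa [fS_vertex hn (by omega) hs (j := i) (by rw [e]; exact hsp), e, hib] at this
  obtain ⟨c2, -⟩ := step _ c3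
  obtain ⟨c1, d1⟩ := step _ c2
  obtain ⟨-, d0⟩ := step _ c1
  have d2 := (step _ c3).2
  have e1 : pt n (n - 2, 1) ∈ C (k + 1) :=
    fS_tip_antepenultimate hn ▸ hf (k + 1) (d2 (n - 3) (by omega))
  have e0 : pt n (n - 2, 1) ∈ C k := fS_tip_antepenultimate hn ▸ hf k (d1 (n - 3) (by omega))
  have f0 : pt n (n - 1, 1) ∈ C k := fS_tip_penultimate hn ▸ hf k e1
  refine Set.eq_univ_of_forall fun z => ?_
  obtain ⟨b, hb, s, hs, rfl⟩ := exists_pt hn0 z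
  refine pt_mem_of_center hn0 (hC k) (h0 k) hb hs.1 hs.2 le_rfl ?_
  obtain hb' | rfl | rfl : b < n - 2 ∨ b = n - 2 ∨ b = n - 1 := by omega
  · exact d0 b hb'
  · exact e0
  · exact f0

/-- The coordinate projections of a proper subcontinuum eventually lie in a single ray and are
mapped injectively by `φ`. -/
lemma exists_level {n : ℕ} (hn : 3 ≤ n) {C : ℕ → Set (Sspace n)} (hC : ∀ k, IsConnected (C k))
    (hf : ∀ k, fS n '' C (k + 1) = C k) {N : ℕ} (hN : ∀ k ≥ N, C k ≠ Set.univ) :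
    ∃ M, ∃ a < n, C M ⊆ ray n a ∧ ∀ k ≥ M, Set.InjOn (fS n) (C (k + 1)) := by
  have hn0 : n ≠ 0 := by omega
  have hmaps : ∀ k, Set.MapsTo (fS n) (C (k + 1)) (C k) := fun k z hz => hf k ▸ ⟨z, hz, rfl⟩
  by_cases h0 : ∀ k, pt n (0, 0) ∈ C k
  · have near : ∀ k ≥ N, ∀ z ∈ C (k + 5), ∃ a < n, ∃ t ∈ Set.Icc (0 : ℝ) 1, z = pt n (a, t) ∧
        par n (a + 1) t < 1 := by
      intro k hk z hz
      obtain ⟨a, ha, t, ht, rfl⟩ := exists_pt hn0 z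
      refine ⟨a, ha, t, ht, rfl, ?_⟩
      by_contra hc
      exact hN k hk (eq_univ_of_far hn (fun k => (hC k).isPreconnected) hmaps h0 ha ht
        (not_lt.1 hc) hz)
    have hray : ∀ k ≥ N, C (k + 5) ⊆ ray n (n - 2) := by
      intro k hk
      rw [← hf]
      rintro _ ⟨z, hz, rfl⟩
      obtain ⟨a, ha, t, ht, rfl, hp⟩ := near (k + 1) (by omega) z hz
      obtain ⟨j, hj, hj1, -, hfz⟩ := fS_pt hn ha ht
      obtain rfl : j = 0 := by
        have : (j : ℝ) < 1 := hj1.trans_lt hp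
        exact_mod_cast Nat.lt_one_iff.1 (by exact_mod_cast this)
      rw [hfz, imgCoord_even hn (by simp) (by simpa using two_le_len hn _), imgCoord_one hn,
        vcoord_pred hn]
      unfold interpC
      simp only [if_true, Nat.cast_zero, sub_zero] at hj1 ⊢
      exact ⟨_, ⟨by linarith, by linarith⟩, rfl⟩
    refine ⟨N + 5, n - 2, by omega, hray N le_rfl, fun k hk => ?_⟩
    obtain ⟨k, rfl⟩ : ∃ i, k = i + 5 := ⟨k - 5, by omega⟩
    have hk' : k + 1 ≥ N := by omega
    have key : ∀ z ∈ C (k + 1 + 5), ∃ t ∈ Set.Icc (0 : ℝ) 1, z = pt n (n - 2, t) ∧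
        par n (n - 2 + 1) t < 1 := by
      intro z hz
      obtain ⟨a, ha, t, ht, rfl, hp⟩ := near _ hk' z hz
      obtain ⟨s, hs, hst⟩ := hray _ hk' hz
      obtain ⟨rfl, h | rfl⟩ := pt_inj hn0 (by omega) ha hs ht hst
      · exact ⟨s, hs, hst.symm, by rw [h, par_zero]; exact one_pos⟩
      · exact ⟨s, hs, rfl, hp⟩
    have hpar0 : ∀ t ∈ Set.Icc (0 : ℝ) 1, ((0 : ℕ) : ℝ) ≤ par n (n - 2 + 1) t := fun t ht => by
      rw [Nat.cast_zero, ← par_zero n (n - 2 + 1)]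
      exact (strictMono_par hn _).monotone ht.1
    intro x hx y hy hxy
    obtain ⟨s, hs, rfl, hps⟩ := key x hx
    obtain ⟨t, ht, rfl, hpt⟩ := key y hy
    rw [fS_inj_edge hn (by omega) hs ht (lt_of_lt_of_le two_pos (two_le_len hn _)) (hpar0 s hs)
      (by simpa using hps.le) (hpar0 t ht) (by simpa using hpt.le) hxy]
  · obtain ⟨K, hK⟩ := not_forall.1 h0
    have hK' : ∀ k ≥ K, pt n (0, 0) ∉ C k := by
      intro k hk
      induction k, hk using Nat.le_induction with
      | base => exact hK
      | succ k _ ih => exact fun h => ih (fS_center hn ▸ hmaps k h)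
    have hray : ∀ k ≥ K, ∃ a < n, C k ⊆ ray n a := fun k hk => subset_ray hn0 (hC k) (hK' k hk)
    have fold : ∀ k ≥ K, ¬ Set.InjOn (fS n) (C (k + 1)) →
        (∃ p ∈ C (k + 1), fS n p ∈ outerVertices n) ∧ ∀ z ∈ outerVertices n, z ∉ C (k + 1) := by
      intro k hk h
      obtain ⟨a, ha, hsub⟩ := hray (k + 1) (by omega)
      exact fold_spec hn (hC _).isPreconnected ha hsub
        (fun z hz hz0 => hK' k hk (hz0 ▸ hmaps k hz)) h
    by_cases hall : ∀ k ≥ K, Set.InjOn (fS n) (C (k + 1))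
    · obtain ⟨a, ha, hsub⟩ := hray K le_rfl
      exact ⟨K, a, ha, hsub, hall⟩
    · push Not at hall
      obtain ⟨L, hL, hLinj⟩ := hall
      obtain ⟨a, ha, hsub⟩ := hray (L + 1) (by omega)
      refine ⟨L + 1, a, ha, hsub, fun k hk => ?_⟩
      by_contra hc
      obtain ⟨⟨p, hp, hpW⟩, -⟩ := fold k (by omega) hc
      have down : ∀ d, (∃ z ∈ C (L + 1 + d), z ∈ outerVertices n) →
          ∃ z ∈ C (L + 1), z ∈ outerVertices n := by
        intro d
        induction d with
        | zero => exact id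
        | succ d ih =>
          rintro ⟨z, hz, hzW⟩
          exact ih ⟨_, hmaps _ hz, fS_mem_outerVertices hn hzW⟩
      obtain ⟨d, rfl⟩ : ∃ d, k = L + 1 + d := ⟨k - (L + 1), by omega⟩
      obtain ⟨z, hz, hzW⟩ := down d ⟨_, hmaps _ hp, hpW⟩
      exact (fold L hL hLinj).2 z hzW hz

/-- A nondegenerate continuum admitting a continuous injection into the line is an arc. -/
lemma isArcSet_of_injective {K : Type*} [TopologicalSpace K] {A : Set K} (hcomp : IsCompact A)
    (hconn : IsConnected A) (hnd : A.Nontrivial) {h : A → ℝ} (hc : Continuous h)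
    (hi : Function.Injective h) : IsArcSet A := by
  have : CompactSpace A := isCompact_iff_compactSpace.1 hcomp
  have : ConnectedSpace A := isConnected_iff_connectedSpace.1 hconn
  have he := hc.isClosedEmbedding hi
  have hr : Set.range h = Set.Icc (sInf (Set.range h)) (sSup (Set.range h)) :=
    eq_Icc_of_connected_compact (isConnected_range hc) (isCompact_range hc)
  have hlt : sInf (Set.range h) < sSup (Set.range h) := by
    obtain ⟨x, hx, y, hy, hxy⟩ := hnd
    have hne : h ⟨x, hx⟩ ≠ h ⟨y, hy⟩ := fun h' => hxy (congrArg Subtype.val (hi h'))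
    have h1 : h ⟨x, hx⟩ ∈ Set.range h := ⟨_, rfl⟩
    have h2 : h ⟨y, hy⟩ ∈ Set.range h := ⟨_, rfl⟩
    rw [hr] at h1 h2
    by_contra hc
    exact hne (by linarith [h1.1, h1.2, h2.1, h2.2])
  exact ⟨he.isEmbedding.toHomeomorph.trans ((Homeomorph.setCongr hr).trans (iccHomeoI _ _ hlt))⟩

/-- A closed subset of `nK` all of whose coordinate projections contain those of `x` contains
`x`. -/
lemma mem_of_forall_mem_image {n : ℕ} {A : Set (nK n)} (hA : IsClosed A) {x : nK n}
    (h : ∀ N, ∃ k ≥ N, x.1 k ∈ (fun y : nK n => y.1 k) '' A) : x ∈ A := by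
  choose k hk y hyA hy using h
  have agree : ∀ m : ℕ, ∀ y : nK n, y.1 m = x.1 m → ∀ j ≤ m, y.1 j = x.1 j := by
    intro m y hm j hj
    induction hj using Nat.decreasingInduction with
    | self => exact hm
    | of_succ j _ ih => rw [← y.2 j, ← x.2 j, ih]
  refine hA.mem_of_tendsto (f := y) (b := Filter.atTop) ?_ (Filter.Eventually.of_forall hyA)
  rw [tendsto_subtype_rng, tendsto_pi_nhds]
  intro j
  refine tendsto_const_nhds.congr' ?_
  filter_upwards [Filter.eventually_ge_atTop j] with N hN
  exact (agree (k N) (y N) (hy N) j (hN.trans (hk N))).symm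

end OdInverseLimit

open OdInverseLimit

/-- For `n ≥ 3`, every proper nondegenerate subcontinuum of the
inverse limit `nK` of the bonding map `φ = nφ` is an arc. -/
theorem statement8 (n : ℕ) (hn : 3 ≤ n)
    (A : Set (nK n)) (hcomp : IsCompact A) (hconn : IsConnected A)
    (hproper : A ≠ Set.univ) (hnd : A.Nontrivial) :
    IsArcSet A := by
  have hmem : ∀ k, IsConnected ((fun y : nK n => y.1 k) '' A) := fun k =>
    hconn.image _ (((continuous_apply k).comp continuous_subtype_val).continuousOn)
  have himg : ∀ k, fS n '' ((fun y : nK n => y.1 (k + 1)) '' A) = (fun y : nK n => y.1 k) '' A :=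
    fun k => by simp only [Set.image_image, fun y : nK n => y.2 k]
  obtain ⟨x, hx⟩ := (Set.ne_univ_iff_exists_notMem A).1 hproper
  obtain ⟨N, hN⟩ : ∃ N, ∀ k ≥ N, x.1 k ∉ (fun y : nK n => y.1 k) '' A := by
    by_contra! hc
    exact hx (mem_of_forall_mem_image hcomp.isClosed hc)
  obtain ⟨M, a, ha, hray, hinj⟩ := exists_level hn hmem himg
    (fun k hk h => hN k hk (h ▸ Set.mem_univ (x.1 k)))
  have hpinj : ∀ y ∈ A, ∀ z ∈ A, y.1 M = z.1 M → y = z := by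
    intro y hy z hz h
    have up : ∀ k ≥ M, y.1 k = z.1 k := by
      intro k hk
      induction k, hk using Nat.le_induction with
      | base => exact h
      | succ k hk ih =>
        exact hinj k hk ⟨y, hy, rfl⟩ ⟨z, hz, rfl⟩ (by simpa only [y.2 k, z.2 k] using ih)
    refine Subtype.ext (funext fun k => ?_)
    rcases le_total M k with hk | hk
    · exact up k hk
    · induction hk using Nat.decreasingInduction with
      | self => exact h
      | of_succ k _ ih => rw [← y.2 k, ← z.2 k, ih]
  refine isArcSet_of_injective hcomp hconn hnd (h := fun y => ‖((y.1.1 M : Sspace n) : ℂ)‖) ?_ ?_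
  · exact (continuous_subtype_val.comp ((continuous_apply M).comp
      (continuous_subtype_val.comp continuous_subtype_val))).norm
  · rintro ⟨y, hy⟩ ⟨z, hz⟩ h
    obtain ⟨s, hs, hsy⟩ := hray ⟨y, hy, rfl⟩
    obtain ⟨t, ht, htz⟩ := hray ⟨z, hz, rfl⟩
    simp only at h hsy htz
    rw [← hsy, ← htz, norm_pt n a hs, norm_pt n a ht] at h
    exact Subtype.ext (hpinj y hy z hz (by rw [← hsy, ← htz, h]))
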